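/- arXiv:2501.10094 — 5 statements merged into one kernel-verified Lean document; each statement's English description precedes it below -/
import Mathlib

section
/- Let k be an algebraically closed field and let n > 1 be an integer such that the characteristic of k does not divide n. Let D = k[x,y]/(xⁿ + yⁿ − 1), which is an integral domain. Then D is Egyptian, i.e., the reciprocal complement R(D) equals the fraction field of D. -/
/-- The reciprocal complement of an integral domain `D` inside a field `K`
(meant to be its fraction field): the subring of `K` generated by the inverses
of the (images of the) nonzero elements of `D`. -/
def reciprocalComplement (D K : Type*) [CommRing D] [Field K] [Algebra D K] : Subring K :=
  Subring.closure {x : K | ∃ d : D, d ≠ 0 ∧ x = (algebraMap D K d)⁻¹}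

theorem algebraMap_mem_reciprocalComplement_of_isUnit {D K : Type*} [CommRing D] [Nontrivial D]
    [Field K] [Algebra D K] {u : D} (hu : IsUnit u) :
    algebraMap D K u ∈ reciprocalComplement D K := by
  obtain ⟨u, rfl⟩ := hu
  refine Subring.subset_closure ⟨↑u⁻¹, Units.ne_zero _, ?_⟩
  exact eq_inv_of_mul_eq_one_left (by rw [← map_mul, Units.mul_inv, map_one])

/-- If the reciprocal complement contains `D`, then `D` is Egyptian. -/
theorem reciprocalComplement_eq_top {D K : Type*} [CommRing D] [IsDomain D] [Field K] [Algebra D K]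
    [IsFractionRing D K] (h : ∀ d : D, algebraMap D K d ∈ reciprocalComplement D K) :
    reciprocalComplement D K = ⊤ := by
  refine eq_top_iff.2 fun z _ ↦ ?_
  obtain ⟨a, b, hb, rfl⟩ := IsFractionRing.div_surjective (A := D) z
  rw [div_eq_mul_inv]
  exact mul_mem (h a) (Subring.subset_closure ⟨b, nonZeroDivisors.ne_zero hb, rfl⟩)

theorem exists_pow_eq_neg_one_ne {k : Type*} [Field k] [IsAlgClosed k] {n : ℕ} (hn : 1 < n)
    (hchar : (n : k) ≠ 0) : ∃ ε ε' : k, ε ^ n = -1 ∧ ε' ^ n = -1 ∧ ε ≠ ε' := by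
  have : NeZero (n : k) := ⟨hchar⟩
  obtain ⟨ε, hε⟩ := IsAlgClosed.exists_pow_nat_eq (-1 : k) (by omega : 0 < n)
  obtain ⟨ζ, hζ⟩ := HasEnoughRootsOfUnity.exists_primitiveRoot k n
  refine ⟨ε, ζ * ε, hε, by rw [mul_pow, hζ.pow_eq_one, hε, one_mul], fun h ↦ hζ.ne_one hn ?_⟩
  have hε0 : ε ≠ 0 := by
    rintro rfl
    simp [show n ≠ 0 by omega] at hε
  exact mul_right_cancel₀ hε0 (by rw [← h, one_mul])

theorem isUnit_sub_mul_of_pow_add_pow_eq_one {D : Type*} [CommRing D] {n : ℕ} {a b c : D}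
    (hab : a ^ n + b ^ n = 1) (hc : c ^ n = -1) : IsUnit (a - c * b) := by
  refine isUnit_of_dvd_one ((sub_dvd_pow_sub_pow a (c * b) n).trans (dvd_of_eq ?_))
  linear_combination hab - b ^ n * hc

open MvPolynomial in
/-- Over an algebraically closed field `k`, if `n > 1` and the
characteristic of `k` does not divide `n`, then `D = k[x,y]/(xⁿ + yⁿ - 1)` is an
Egyptian domain: its reciprocal complement is the whole fraction field. -/
theorem stmt1 (k : Type*) [Field k] [IsAlgClosed k] (n : ℕ) (hn : 1 < n)
    (hchar : ¬ (ringChar k ∣ n))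
    (D : Type*) [CommRing D] [IsDomain D]
    (e : (MvPolynomial (Fin 2) k ⧸
        Ideal.span {(X 0 : MvPolynomial (Fin 2) k) ^ n + (X 1) ^ n - 1}) ≃+* D) :
    reciprocalComplement D (FractionRing D) = ⊤ := by
  have hn0 : (n : k) ≠ 0 := fun h ↦ hchar ((ringChar.spec k n).1 h)
  obtain ⟨ε, ε', hε, hε', hne⟩ := exists_pow_eq_neg_one_ne hn hn0
  let φ : MvPolynomial (Fin 2) k →+* D := e.toRingHom.comp (Ideal.Quotient.mk _)
  have hφ : Function.Surjective φ := e.surjective.comp Ideal.Quotient.mk_surjective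
  have hxy : φ (X 0) ^ n + φ (X 1) ^ n = 1 := by
    rw [← sub_eq_zero, ← map_pow, ← map_pow, ← map_add, ← map_one φ, ← map_sub]
    exact (congrArg e (Ideal.Quotient.eq_zero_iff_mem.2
      (Ideal.mem_span_singleton_self _))).trans (map_zero e)
  let S : Subring D := (reciprocalComplement D (FractionRing D)).comap (algebraMap D _)
  have hS {u : D} (hu : IsUnit u) : u ∈ S := algebraMap_mem_reciprocalComplement_of_isUnit hu
  have hC (c : k) : φ (C c) ∈ S := by
    rcases eq_or_ne c 0 with rfl | hc
    · simp
    · exact hS ((hc.isUnit.map C).map φ)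
  have hroot {c : k} (hc : c ^ n = -1) : φ (X 0) - φ (C c) * φ (X 1) ∈ S :=
    hS (isUnit_sub_mul_of_pow_add_pow_eq_one hxy (by simp [← map_pow, hc]))
  have hy : φ (X 1) ∈ S := by
    have h1 : φ (C (ε' - ε)⁻¹) * (φ (C ε') - φ (C ε)) = 1 := by
      rw [← map_sub, ← map_mul, ← C_sub, ← C_mul, inv_mul_cancel₀ (sub_ne_zero.2 hne.symm),
        C_1, map_one]
    have h2 := mul_mem (hC (ε' - ε)⁻¹) (sub_mem (hroot hε) (hroot hε'))
    convert h2 using 1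
    linear_combination -φ (X 1) * h1
  have hx : φ (X 0) ∈ S := by
    simpa using add_mem (hroot hε) (mul_mem (hC ε) hy)
  refine reciprocalComplement_eq_top fun d ↦ ?_
  obtain ⟨p, rfl⟩ := hφ d
  change φ p ∈ S
  induction p using MvPolynomial.induction_on with
  | C c => exact hC c
  | add p q hp hq => simpa using add_mem hp hq
  | mul_X p i hp =>
    rw [map_mul]
    refine mul_mem hp ?_
    fin_cases i
    exacts [hx, hy]
end

section
/- Let k be an algebraically closed field of characteristic different from 2 and 3, and let a, b ∈ k. Let D = k[x,y]/(y² − x³ − ax − b), which is an integral domain. Then D is not Egyptian: the reciprocal complement R(D) is a proper subring of the fraction field of D. -/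
/-- A domain carrying a nonconstant degree function (the negative of a valuation that is
nonpositive on the domain) has a proper reciprocal complement. -/
theorem reciprocalComplement_ne_top_of_degree {D K : Type*} [CommRing D] [IsDomain D] [Field K]
    [Algebra D K] [IsFractionRing D K] (deg : D → WithBot ℕ)
    (deg_eq_bot : ∀ f, deg f = ⊥ ↔ f = 0) (deg_one : deg 1 = 0)
    (deg_mul : ∀ f g, deg (f * g) = deg f + deg g)
    (deg_add : ∀ f g, deg (f + g) ≤ max (deg f) (deg g))
    (x : D) (hx : 0 < deg x) : reciprocalComplement D K ≠ ⊤ := by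
  have deg_nonneg {f : D} (hf : f ≠ 0) : 0 ≤ deg f := by
    have h := mt (deg_eq_bot f).mp hf
    cases hd : deg f with
    | bot => exact absurd hd h
    | coe n => exact WithBot.coe_le_coe.mpr (Nat.zero_le n)
  have deg_neg (f : D) : deg (-f) = deg f := by
    have h1 : deg (-1) = 0 := by
      have h := deg_mul (-1) (-1)
      rw [neg_mul_neg, one_mul, deg_one] at h
      have h0 := deg_nonneg (neg_ne_zero.mpr (one_ne_zero (α := D)))
      refine le_antisymm ?_ h0
      calc deg (-1) ≤ deg (-1) + deg (-1) := le_add_of_nonneg_right h0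
        _ = 0 := h.symm
    rw [← neg_one_mul, deg_mul, h1, zero_add]
  have map_ne {f : D} (hf : f ≠ 0) : algebraMap D K f ≠ 0 := by
    simpa using hf
  let S : Subring K :=
    { carrier := {z | ∃ f g : D, g ≠ 0 ∧ deg f ≤ deg g ∧ z = algebraMap D K f / algebraMap D K g}
      zero_mem' := ⟨0, 1, one_ne_zero, by simp [(deg_eq_bot 0).mpr rfl], by simp⟩
      one_mem' := ⟨1, 1, one_ne_zero, le_rfl, by simp⟩
      neg_mem' := by
        rintro _ ⟨f, g, hg, h, rfl⟩
        exact ⟨-f, g, hg, by rwa [deg_neg], by rw [map_neg, neg_div]⟩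
      mul_mem' := by
        rintro _ _ ⟨f, g, hg, h, rfl⟩ ⟨f', g', hg', h', rfl⟩
        refine ⟨f * f', g * g', mul_ne_zero hg hg', ?_, ?_⟩
        · rw [deg_mul, deg_mul]
          exact add_le_add h h'
        · rw [map_mul, map_mul, div_mul_div_comm]
      add_mem' := by
        rintro _ _ ⟨f, g, hg, h, rfl⟩ ⟨f', g', hg', h', rfl⟩
        refine ⟨f * g' + g * f', g * g', mul_ne_zero hg hg', (deg_add _ _).trans ?_, ?_⟩
        · simp only [deg_mul]
          exact max_le (add_le_add h le_rfl) (add_le_add le_rfl h')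
        · rw [div_add_div _ _ (map_ne hg) (map_ne hg')]
          simp only [map_add, map_mul] }
  have hle : reciprocalComplement D K ≤ S := by
    refine Subring.closure_le.mpr ?_
    rintro _ ⟨d, hd, rfl⟩
    exact ⟨1, d, hd, by rw [deg_one]; exact deg_nonneg hd, by rw [map_one, one_div]⟩
  intro htop
  obtain ⟨f, g, hg, h, hfg⟩ := hle (htop ▸ Subring.mem_top (algebraMap D K x))
  rw [eq_div_iff (map_ne hg), ← map_mul] at hfg
  rw [← IsFractionRing.injective D K hfg, deg_mul] at h
  have hbot : deg g ≠ ⊥ := mt (deg_eq_bot g).mp hg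
  exact absurd h (not_le.mpr (by
    simpa using WithBot.add_lt_add_right hbot hx))

namespace WeierstrassCurve.Affine.CoordinateRing

open Polynomial

theorem degree_norm_add_le {R : Type*} [CommRing R] [IsDomain R] {W : WeierstrassCurve.Affine R}
    (f g : W.CoordinateRing) :
    (Algebra.norm R[X] (f + g)).degree ≤
      max (Algebra.norm R[X] f).degree (Algebra.norm R[X] g).degree := by
  obtain ⟨p, q, rfl⟩ := exists_smul_basis_eq f
  obtain ⟨p', q', rfl⟩ := exists_smul_basis_eq g
  rw [add_add_add_comm, ← add_smul, ← add_smul]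
  simp only [degree_norm_smul_basis]
  refine max_le ?_ ?_
  · rcases le_max_iff.mp (degree_add_le p p') with h | h
    · exact le_max_of_le_left (le_max_of_le_left (nsmul_le_nsmul_right h 2))
    · exact le_max_of_le_right (le_max_of_le_left (nsmul_le_nsmul_right h 2))
  · rcases le_max_iff.mp (degree_add_le q q') with h | h
    · exact le_max_of_le_left (le_max_of_le_right (by gcongr))
    · exact le_max_of_le_right (le_max_of_le_right (by gcongr))

theorem degree_norm_X {R : Type*} [CommRing R] [IsDomain R] {W : WeierstrassCurve.Affine R} :
    (Algebra.norm R[X] (algebraMap R[X] W.CoordinateRing X)).degree = 2 := by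
  have h := degree_norm_smul_basis (W' := W) X 0
  rw [zero_smul, add_zero, ← Algebra.algebraMap_eq_smul_one] at h
  rw [h]
  simp

end WeierstrassCurve.Affine.CoordinateRing

theorem WeierstrassCurve.Affine.eval₂_polynomial_short {R S : Type*} [CommRing R] [CommRing S]
    (a b : R) (f : Polynomial R →+* S) (s : S) :
    (WeierstrassCurve.Affine.polynomial ⟨0, 0, 0, a, b⟩).eval₂ f s =
      s ^ 2 - (f Polynomial.X ^ 3 + f (Polynomial.C a) * f Polynomial.X + f (Polynomial.C b)) := by
  rw [WeierstrassCurve.Affine.polynomial, Polynomial.eval₂_sub, Polynomial.eval₂_C]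
  simp

/-- The quotient presentation `k[x,y]/(y² - x³ - ax - b)` embeds in Mathlib's affine coordinate
ring of the curve. -/
theorem exists_injective_coordinateRing {k : Type*} [Field k] (a b : k) :
    ∃ ψ : (MvPolynomial (Fin 2) k ⧸ Ideal.span {(MvPolynomial.X 1 : MvPolynomial (Fin 2) k) ^ 2 -
          (MvPolynomial.X 0) ^ 3 - MvPolynomial.C a * MvPolynomial.X 0 - MvPolynomial.C b}) →+*
        WeierstrassCurve.Affine.CoordinateRing (⟨0, 0, 0, a, b⟩ : WeierstrassCurve.Affine k),
      Function.Injective ψ ∧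
        ψ (Ideal.Quotient.mk _ (MvPolynomial.X 0)) = algebraMap (Polynomial k) _ Polynomial.X := by
  set W : WeierstrassCurve.Affine k := ⟨0, 0, 0, a, b⟩
  set I := Ideal.span {(MvPolynomial.X 1 : MvPolynomial (Fin 2) k) ^ 2 -
    (MvPolynomial.X 0) ^ 3 - MvPolynomial.C a * MvPolynomial.X 0 - MvPolynomial.C b}
  let x : W.CoordinateRing := algebraMap (Polynomial k) _ Polynomial.X
  let y : W.CoordinateRing := AdjoinRoot.root W.polynomial
  let ev : MvPolynomial (Fin 2) k →ₐ[k] W.CoordinateRing := MvPolynomial.aeval ![x, y]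
  have hev : ∀ f ∈ I, ev f = 0 := by
    intro f hf
    refine (RingHom.mem_ker (f := ev)).mp ((Ideal.span_singleton_le_iff_mem _).mpr ?_ hf)
    have hroot := AdjoinRoot.eval₂_root W.polynomial
    rw [WeierstrassCurve.Affine.eval₂_polynomial_short] at hroot
    have hC (c : k) : AdjoinRoot.of W.polynomial (Polynomial.C c) =
        algebraMap k W.CoordinateRing c := rfl
    rw [hC, hC] at hroot
    change y ^ 2 - (x ^ 3 + _ * x + _) = 0 at hroot
    rw [RingHom.mem_ker]
    simp only [ev, map_sub, map_pow, map_mul, MvPolynomial.aeval_X, MvPolynomial.aeval_C,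
      Matrix.cons_val_zero, Matrix.cons_val_one]
    linear_combination hroot
  let ψ := Ideal.Quotient.liftₐ I ev hev
  let i : Polynomial k →ₐ[k] MvPolynomial (Fin 2) k ⧸ I :=
    Polynomial.aeval (Ideal.Quotient.mk I (MvPolynomial.X 0))
  have hroot : W.polynomial.eval₂ (i : Polynomial k →+* _)
      (Ideal.Quotient.mk I (MvPolynomial.X 1)) = 0 := by
    have h : Ideal.Quotient.mk I _ = 0 :=
      Ideal.Quotient.eq_zero_iff_mem.mpr (Ideal.mem_span_singleton_self _)
    have hC (c : k) : i (Polynomial.C c) = Ideal.Quotient.mk I (MvPolynomial.C c) :=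
      i.commutes c
    rw [WeierstrassCurve.Affine.eval₂_polynomial_short]
    simp only [RingHom.coe_coe, hC]
    simp only [map_sub, map_pow, map_mul] at h
    simp only [i, Polynomial.aeval_X]
    linear_combination h
  have hψ (f : MvPolynomial (Fin 2) k) : ψ (Ideal.Quotient.mk I f) = ev f := rfl
  let χ := AdjoinRoot.liftAlgHom W.polynomial i _ hroot
  have hcomp : χ.comp ψ = AlgHom.id k _ := by
    apply Ideal.Quotient.algHom_ext
    apply MvPolynomial.algHom_ext
    intro j
    fin_cases j
    · change χ (ψ (Ideal.Quotient.mk I (MvPolynomial.X 0))) = _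
      rw [hψ]
      simp [χ, ev, x, i]
    · change χ (ψ (Ideal.Quotient.mk I (MvPolynomial.X 1))) = _
      rw [hψ]
      simp [χ, ev, y]
  refine ⟨ψ, ?_, ?_⟩
  · exact Function.LeftInverse.injective (g := χ) fun z => DFunLike.congr_fun hcomp z
  · change ψ (Ideal.Quotient.mk I (MvPolynomial.X 0)) = _
    rw [hψ]
    simp [ev, x]

open MvPolynomial in
/-- Over an algebraically closed field `k` of characteristic
different from `2` and `3`, the coordinate ring `D = k[x,y]/(y² - x³ - ax - b)`
of a (possibly singular) affine elliptic curve is not Egyptian: its reciprocal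
complement is a proper subring of the fraction field. -/
theorem stmt2 (k : Type*) [Field k] [IsAlgClosed k]
    (h2 : ringChar k ≠ 2) (h3 : ringChar k ≠ 3) (a b : k)
    (D : Type*) [CommRing D] [IsDomain D]
    (e : (MvPolynomial (Fin 2) k ⧸
        Ideal.span {(X 1 : MvPolynomial (Fin 2) k) ^ 2 - (X 0) ^ 3 - C a * X 0 - C b}) ≃+* D) :
    reciprocalComplement D (FractionRing D) ≠ ⊤ := by
  obtain ⟨ψ, hψ, hx⟩ := exists_injective_coordinateRing a b
  have hinj : Function.Injective fun d => ψ (e.symm d) := hψ.comp e.symm.injective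
  refine reciprocalComplement_ne_top_of_degree
    (fun d => (Algebra.norm (Polynomial k) (ψ (e.symm d))).degree)
    (fun f => ?_) (by simp) (fun f g => by simp) (fun f g => ?_)
    (e (Ideal.Quotient.mk _ (X 0))) ?_
  · rw [Polynomial.degree_eq_bot,
      Algebra.norm_eq_zero_iff_of_basis (WeierstrassCurve.Affine.CoordinateRing.basis _)]
    exact ⟨fun h => hinj (by simpa using h), fun h => by simp [h]⟩
  · simpa only [map_add] using
      WeierstrassCurve.Affine.CoordinateRing.degree_norm_add_le (ψ (e.symm f)) (ψ (e.symm g))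
  · simp only [RingEquiv.symm_apply_apply, hx,
      WeierstrassCurve.Affine.CoordinateRing.degree_norm_X]
    exact two_pos
end

section
/- Let k be a field, let D be an integral domain that is a k-algebra (with k ⊆ D), and let K be the fraction field of D. Let V be a valuation subring of K containing (the image of) k. If every element f ∈ D with f ∉ k satisfies f ∉ V, then R(D) ⊆ V. In particular, if moreover V ≠ K, then R(D) ≠ K, i.e., D is not Egyptian. -/
/-- Let `D` be a domain that is an algebra over a field `k`,
with fraction field `K`, and let `V` be a valuation subring of `K` containing
the image of `k`. If no element of `D` outside (the image of) `k` belongs to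
`V`, then `R(D) ⊆ V`; in particular, if moreover `V ≠ K`, then `R(D) ≠ K`,
i.e. `D` is not Egyptian. -/
theorem stmt5 (k : Type*) [Field k] (D : Type*) [CommRing D] [IsDomain D] [Algebra k D]
    (K : Type*) [Field K] [Algebra D K] [IsFractionRing D K]
    (V : ValuationSubring K)
    (hkV : ∀ c : k, algebraMap D K (algebraMap k D c) ∈ V)
    (hDV : ∀ f : D, f ∉ Set.range (algebraMap k D) → algebraMap D K f ∉ V) :
    reciprocalComplement D K ≤ V.toSubring ∧
      (V ≠ ⊤ → reciprocalComplement D K ≠ ⊤) := by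
  have hle : reciprocalComplement D K ≤ V.toSubring := by
    refine Subring.closure_le.2 ?_
    rintro _ ⟨d, -, rfl⟩
    by_cases hd : d ∈ Set.range (algebraMap k D)
    · obtain ⟨c, rfl⟩ := hd
      have hc := hkV c⁻¹
      rwa [← RingHom.comp_apply, map_inv₀, RingHom.comp_apply] at hc
    · exact (V.mem_or_inv_mem _).resolve_left (hDV d hd)
  refine ⟨hle, fun hV htop => hV (eq_top_iff.2 fun x _ => ?_)⟩
  exact hle (htop ▸ Subring.mem_top x)
end

section
/- Let k be an algebraically closed field and let D be a finitely generated integral k-algebra of Krull dimension 1, with fraction field K. Then R(D) ≠ K if and only if there exists a valuation subring V of K with V ≠ K, containing (the image of) k, such that every element f ∈ D with f ∉ k satisfies f ∉ V. (Such a V is automatically a discrete valuation ring, since K has transcendence degree 1 over k.) -/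
open Cardinal in
/-- An integral domain finitely generated over a field has transcendence degree at most its
Krull dimension. -/
theorem trdeg_le_of_ringKrullDim_le {k D : Type*} [Field k] [CommRing D] [IsDomain D] [Algebra k D]
    [Algebra.FiniteType k D] {n : ℕ} (hdim : ringKrullDim D ≤ n) : Algebra.trdeg k D ≤ n := by
  obtain ⟨s, g, hinj, hint⟩ := exists_integral_inj_algHom_of_fg k D
  algebraize [g.toRingHom]
  have : Algebra.IsIntegral (MvPolynomial (Fin s) k) D := ⟨hint⟩
  have : FaithfulSMul (MvPolynomial (Fin s) k) D :=
    (faithfulSMul_iff_algebraMap_injective _ _).mpr hinj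
  have hs : s ≤ n := by
    have h : ringKrullDim (MvPolynomial (Fin s) k) ≤ ringKrullDim D := by
      refine iSup_le fun l ↦ ?_
      obtain ⟨P, _, _⟩ := Ideal.nonempty_primesOver (S := D) (RelSeries.head l).asIdeal
      obtain ⟨L, hL, -⟩ := Ideal.exists_ltSeries_of_hasGoingUp (S := D) l P
      exact hL ▸ Order.LTSeries.length_le_krullDim L
    rw [MvPolynomial.ringKrullDim_of_isNoetherianRing, ringKrullDim_eq_zero_of_field] at h
    simpa using h.trans hdim
  have hX := (IsTranscendenceBasis.mvPolynomial (Fin s) k).algebraMap_comp (A := D)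
  have := hX.lift_cardinalMk_eq_trdeg
  rw [mk_fin, lift_natCast, lift_uzero] at this
  exact this ▸ Nat.cast_le.mpr hs

/-- In a domain of transcendence degree one, a transcendental element generates a subalgebra
over which everything is algebraic. -/
theorem Transcendental.isAlgebraic_adjoin_singleton {k D : Type*} [Field k] [CommRing D]
    [IsDomain D] [Algebra k D] {f : D} (hf : Transcendental k f) (htr : Algebra.trdeg k D ≤ 1) :
    Algebra.IsAlgebraic (Algebra.adjoin k {f}) D := by
  have hind : AlgebraicIndependent k fun _ : Unit ↦ f := algebraicIndependent_unique_type_iff.mpr hf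
  have hbasis := hind.isTranscendenceBasis_of_lift_trdeg_le_of_finite (by simpa using htr)
  have := hbasis.isAlgebraic
  rwa [Set.range_const] at this

/-- A subring of a field that is not closed under inversion lies in a nontrivial valuation
subring. -/
theorem Subring.exists_le_valuationSubring_ne_top {K : Type*} [Field K] {R : Subring K} {x : K}
    (hx : x ∈ R) (hx0 : x ≠ 0) (hxinv : x⁻¹ ∉ R) :
    ∃ V : ValuationSubring K, R ≤ V.toSubring ∧ V ≠ ⊤ := by
  have hI : Ideal.span {(⟨x, hx⟩ : R)} ≠ ⊤ := by
    rw [Ne, Ideal.span_singleton_eq_top, isUnit_iff_exists_inv]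
    rintro ⟨⟨y, hy⟩, hxy⟩
    exact hxinv (inv_eq_of_mul_eq_one_right (congrArg Subtype.val hxy) ▸ hy)
  obtain ⟨V, hRV, hV⟩ := Ideal.image_subset_nonunits_valuationSubring _ hI
  refine ⟨V, hRV, ?_⟩
  rintro rfl
  have hxV : x ∈ (⊤ : ValuationSubring K).nonunits :=
    hV ⟨_, Ideal.mem_span_singleton_self _, rfl⟩
  exact ((ValuationSubring.mem_nonunits_iff_or _).mp hxV).elim hx0 (· (ValuationSubring.mem_top _))

theorem inv_algebraMap_mem_reciprocalComplement {D K : Type*} [CommRing D] [Field K] [Algebra D K]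
    {d : D} (hd : d ≠ 0) : (algebraMap D K d)⁻¹ ∈ reciprocalComplement D K :=
  Subring.subset_closure ⟨d, hd, rfl⟩

/-- A proper reciprocal complement of a domain lies in a nontrivial valuation subring. -/
theorem exists_valuationSubring_of_reciprocalComplement_ne_top {D K : Type*} [CommRing D]
    [IsDomain D] [Field K] [Algebra D K] [IsFractionRing D K] (h : reciprocalComplement D K ≠ ⊤) :
    ∃ V : ValuationSubring K, reciprocalComplement D K ≤ V.toSubring ∧ V ≠ ⊤ := by
  obtain ⟨d, hd⟩ : ∃ d : D, algebraMap D K d ∉ reciprocalComplement D K := by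
    by_contra! hD
    refine h (eq_top_iff.mpr fun x _ ↦ ?_)
    obtain ⟨a, b, hb, rfl⟩ := IsFractionRing.div_surjective (A := D) x
    rw [div_eq_mul_inv]
    exact mul_mem (hD a) (inv_algebraMap_mem_reciprocalComplement (nonZeroDivisors.ne_zero hb))
  have hd0 : d ≠ 0 := by
    rintro rfl
    exact hd (by simp)
  exact Subring.exists_le_valuationSubring_ne_top (inv_algebraMap_mem_reciprocalComplement hd0)
    (by simpa using hd0) (by simpa using hd)

/-- A valuation subring that contains a subalgebra `A` of `D` together with the inverses of its
nonzero elements is trivial if the fraction field is algebraic over `A`. -/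
theorem ValuationSubring.eq_top_of_isAlgebraic {k D K : Type*} [Field k] [CommRing D] [IsDomain D]
    [Algebra k D] [Field K] [Algebra D K] [IsFractionRing D K] (A : Subalgebra k D)
    [Algebra.IsAlgebraic A D] {V : ValuationSubring K} (hA : ∀ a ∈ A, algebraMap D K a ∈ V)
    (hAinv : ∀ a ∈ A, a ≠ 0 → (algebraMap D K a)⁻¹ ∈ V) : V = ⊤ := by
  have : Algebra.IsAlgebraic D K := IsLocalization.isAlgebraic K (nonZeroDivisors D)
  have : Algebra.IsAlgebraic A K := .trans A D K
  refine _root_.eq_top_iff.mpr fun x _ ↦ ?_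
  obtain ⟨a, ha0, ha⟩ := (Algebra.IsAlgebraic.isAlgebraic (R := A) x).exists_integral_multiple
  let φ : A →+* V := ((algebraMap D K).comp A.val.toRingHom).codRestrict V.toSubring
    fun a ↦ hA a a.2
  have hint : IsIntegral V (a • x) := by
    obtain ⟨p, hp, hpx⟩ := ha
    exact ⟨p.map φ, hp.map φ, by rw [Polynomial.eval₂_map]; exact hpx⟩
  obtain ⟨y, hy⟩ := IsIntegrallyClosed.isIntegral_iff.mp hint
  have hD0 : (a : D) ≠ 0 := by simpa using ha0
  have hK0 : algebraMap D K a ≠ 0 := by simpa using hD0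
  have hx : x = (algebraMap D K a)⁻¹ * y := by
    rw [eq_inv_mul_iff_mul_eq₀ hK0]
    exact (Algebra.smul_def a x).symm.trans hy.symm
  rw [hx]
  exact V.mul_mem _ _ (hAinv a a.2 hD0) y.2

/-- Let `k` be an algebraically closed field and `D` a finitely
generated integral `k`-algebra of Krull dimension `1`, with fraction field `K`.
Then `R(D) ≠ K` if and only if there is a proper valuation subring `V` of `K`
containing the image of `k` such that no element of `D` outside (the image of)
`k` belongs to `V`. -/
theorem stmt6 (k : Type*) [Field k] [IsAlgClosed k]
    (D : Type*) [CommRing D] [IsDomain D] [Algebra k D] [Algebra.FiniteType k D]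
    (hdim : ringKrullDim D = 1)
    (K : Type*) [Field K] [Algebra D K] [IsFractionRing D K] :
    reciprocalComplement D K ≠ ⊤ ↔
      ∃ V : ValuationSubring K, V ≠ ⊤ ∧
        (∀ c : k, algebraMap D K (algebraMap k D c) ∈ V) ∧
        (∀ f : D, f ∉ Set.range (algebraMap k D) → algebraMap D K f ∉ V) := by
  constructor
  · intro h
    obtain ⟨V, hRV, hV⟩ := exists_valuationSubring_of_reciprocalComplement_ne_top h
    have hinv (d : D) (hd : d ≠ 0) : (algebraMap D K d)⁻¹ ∈ V :=
      hRV (inv_algebraMap_mem_reciprocalComplement hd)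
    have hk (c : k) : algebraMap D K (algebraMap k D c) ∈ V := by
      obtain rfl | hc := eq_or_ne c 0
      · simp
      · have := hinv (algebraMap k D c⁻¹) (by simpa using hc)
        rwa [← RingHom.comp_apply, ← map_inv₀, inv_inv] at this
    refine ⟨V, hV, hk, fun f hf hfV ↦ hV ?_⟩
    have htrans : Transcendental k f := fun halg ↦ hf <|
      minpoly.mem_range_of_degree_eq_one k f <|
        IsAlgClosed.degree_eq_one_of_irreducible k (minpoly.irreducible halg.isIntegral)
    have := htrans.isAlgebraic_adjoin_singleton
      (by simpa using trdeg_le_of_ringKrullDim_le (k := k) (n := 1) hdim.le)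
    refine ValuationSubring.eq_top_of_isAlgebraic (Algebra.adjoin k {f}) (fun a ha ↦ ?_)
      fun a _ ↦ hinv a
    induction ha using Algebra.adjoin_induction with
    | mem x hx => exact Set.mem_singleton_iff.mp hx ▸ hfV
    | algebraMap c => exact hk c
    | add x y _ _ hx hy => simpa using add_mem hx hy
    | mul x y _ _ hx hy => simpa using mul_mem hx hy
  · rintro ⟨V, hV, hk, hD⟩ h
    have hle : reciprocalComplement D K ≤ V.toSubring := by
      refine Subring.closure_le.mpr ?_
      rintro _ ⟨d, hd, rfl⟩
      by_cases hdk : d ∈ Set.range (algebraMap k D)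
      · obtain ⟨c, rfl⟩ := hdk
        have := hk c⁻¹
        rwa [← RingHom.comp_apply, map_inv₀] at this
      · exact (V.mem_or_inv_mem _).resolve_left (hD d hdk)
    exact hV (eq_top_iff.mpr fun x _ ↦ hle (h ▸ Subring.mem_top x))
end

section
/- Let k be a field, let D be an integral domain that is a k-algebra (with k ⊆ D), and let K be the fraction field of D. Let v be a ℤ-valued (additive, discrete) valuation on K such that v(c) = 0 for every nonzero c ∈ k. Let μ be a positive integer such that v(g) ≤ −μ for every g ∈ D with g ∉ k. Then for every nonzero f ∈ R(D), either v(f) = 0 or v(f) ≥ μ; in particular, v(f) ≥ 0 and v(f) ∉ {1, 2, …, μ−1}. -/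
/-- Elements of a ring generated by elements congruent to constants modulo elements of valuation
at least `μ` are themselves congruent to constants modulo such elements. -/
theorem exists_const_add_of_mem_closure {k K : Type*} [Field k] [Field K] (φ : k →+* K)
    (v : K → ℤ) (hmul : ∀ a b : K, a ≠ 0 → b ≠ 0 → v (a * b) = v a + v b)
    (hadd : ∀ a b : K, a ≠ 0 → b ≠ 0 → a + b ≠ 0 → min (v a) (v b) ≤ v (a + b))
    (hconst : ∀ c : k, c ≠ 0 → v (φ c) = 0) {μ : ℤ} (hμ : 0 < μ) {s : Set K}
    (hs : ∀ x ∈ s, ∃ c y, x = φ c + y ∧ (y = 0 ∨ μ ≤ v y)) {f : K}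
    (hf : f ∈ Subring.closure s) : ∃ c y, f = φ c + y ∧ (y = 0 ∨ μ ≤ v y) := by
  have small_add (y z : K) (hy : y = 0 ∨ μ ≤ v y) (hz : z = 0 ∨ μ ≤ v z) :
      y + z = 0 ∨ μ ≤ v (y + z) := by
    by_cases hy0 : y = 0
    · simpa [hy0] using hz
    by_cases hz0 : z = 0
    · simpa [hz0] using hy
    by_cases hyz : y + z = 0
    · exact Or.inl hyz
    exact Or.inr ((le_min (hy.resolve_left hy0) (hz.resolve_left hz0)).trans
      (hadd y z hy0 hz0 hyz))
  have small_const_mul (c : k) (y : K) (hy : y = 0 ∨ μ ≤ v y) :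
      φ c * y = 0 ∨ μ ≤ v (φ c * y) := by
    by_cases hy0 : y = 0
    · simp [hy0]
    by_cases hc : c = 0
    · simp [hc]
    rw [hmul _ _ ((map_ne_zero φ).2 hc) hy0, hconst c hc, zero_add]
    exact Or.inr (hy.resolve_left hy0)
  have small_mul (y z : K) (hy : y = 0 ∨ μ ≤ v y) (hz : z = 0 ∨ μ ≤ v z) :
      y * z = 0 ∨ μ ≤ v (y * z) := by
    by_cases hy0 : y = 0
    · simp [hy0]
    by_cases hz0 : z = 0
    · simp [hz0]
    rw [hmul y z hy0 hz0]
    have := hy.resolve_left hy0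
    have := hz.resolve_left hz0
    exact Or.inr (by lia)
  induction hf using Subring.closure_induction with
  | mem x hx => exact hs x hx
  | zero => exact ⟨0, 0, by simp⟩
  | one => exact ⟨1, 0, by simp⟩
  | add x y _ _ hx hy =>
    obtain ⟨c, p, rfl, hp⟩ := hx
    obtain ⟨d, q, rfl, hq⟩ := hy
    exact ⟨c + d, p + q, by rw [map_add]; ring, small_add p q hp hq⟩
  | neg x _ hx =>
    obtain ⟨c, p, rfl, hp⟩ := hx
    exact ⟨-c, φ (-1) * p, by rw [map_neg, map_neg, map_one]; ring, small_const_mul (-1) p hp⟩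
  | mul x y _ _ hx hy =>
    obtain ⟨c, p, rfl, hp⟩ := hx
    obtain ⟨d, q, rfl, hq⟩ := hy
    exact ⟨c * d, φ c * q + φ d * p + p * q, by rw [map_mul]; ring,
      small_add _ _ (small_add _ _ (small_const_mul c q hq) (small_const_mul d p hp))
        (small_mul p q hp hq)⟩

/-- Let `D` be a domain that is an algebra over a field `k`,
with fraction field `K`, and let `v` be a ℤ-valued additive valuation on `K`
vanishing on the nonzero constants. If `μ > 0` is such that `v g ≤ -μ` for every
`g ∈ D` not in (the image of) `k`, then every nonzero `f ∈ R(D)` satisfies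
`v f = 0` or `v f ≥ μ` (so in particular `v f ≥ 0` and `v f ∉ {1, …, μ-1}`). -/
theorem stmt8 (k : Type*) [Field k] (D : Type*) [CommRing D] [IsDomain D] [Algebra k D]
    (K : Type*) [Field K] [Algebra D K] [IsFractionRing D K]
    (v : K → ℤ)
    (hmul : ∀ a b : K, a ≠ 0 → b ≠ 0 → v (a * b) = v a + v b)
    (hadd : ∀ a b : K, a ≠ 0 → b ≠ 0 → a + b ≠ 0 → min (v a) (v b) ≤ v (a + b))
    (hconst : ∀ c : k, c ≠ 0 → v (algebraMap D K (algebraMap k D c)) = 0)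
    (μ : ℤ) (hμ : 0 < μ)
    (hD : ∀ g : D, g ∉ Set.range (algebraMap k D) → v (algebraMap D K g) ≤ -μ) :
    ∀ f ∈ reciprocalComplement D K, f ≠ 0 → v f = 0 ∨ μ ≤ v f := by
  have hv1 : v 1 = 0 := by simpa using hconst 1 one_ne_zero
  have hv_inv (x : K) (hx : x ≠ 0) : v x⁻¹ = -v x := by
    have h := hmul x x⁻¹ hx (inv_ne_zero hx)
    rw [mul_inv_cancel₀ hx, hv1] at h
    lia
  have hv_neg (x : K) (hx : x ≠ 0) : v (-x) = v x := by
    have h := hmul (-1) x (by simp) hx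
    have h1 : v (-1) = 0 := by simpa using hconst (-1) (by simp)
    rwa [neg_one_mul, h1, zero_add] at h
  intro f hf hf0
  let φ : k →+* K := (algebraMap D K).comp (algebraMap k D)
  have hgen : ∀ x ∈ {x : K | ∃ d : D, d ≠ 0 ∧ x = (algebraMap D K d)⁻¹},
      ∃ c y, x = φ c + y ∧ (y = 0 ∨ μ ≤ v y) := by
    rintro _ ⟨d, hd, rfl⟩
    by_cases hdk : d ∈ Set.range (algebraMap k D)
    · obtain ⟨c, rfl⟩ := hdk
      exact ⟨c⁻¹, 0, by rw [map_inv₀, add_zero]; rfl, Or.inl rfl⟩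
    · refine ⟨0, (algebraMap D K d)⁻¹, by simp, Or.inr ?_⟩
      rw [hv_inv _ (by simpa using hd)]
      have := hD d hdk
      lia
  obtain ⟨c, y, rfl, hy⟩ := exists_const_add_of_mem_closure φ v hmul hadd hconst hμ hgen hf
  by_cases hc : c = 0
  · subst hc
    rw [map_zero, zero_add] at hf0 ⊢
    exact Or.inr (hy.resolve_left hf0)
  have hvc : v (φ c) = 0 := hconst c hc
  by_cases hy0 : y = 0
  · exact Or.inl (by rwa [hy0, add_zero])
  have hφc : φ c ≠ 0 := (map_ne_zero φ).2 hc
  have hvy := hy.resolve_left hy0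
  have hlow := hadd (φ c) y hφc hy0 hf0
  have hup := hadd (φ c + y) (-y) hf0 (neg_ne_zero.2 hy0) (by simpa using hφc)
  rw [add_neg_cancel_right, hv_neg y hy0] at hup
  lia
end
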